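/- The type-I cubic spline strictly minimizes the bending energy among all admissible interpolants: if s is a function of class C² on [0,1] whose restriction to each interval [x_j, x_{j+1}] (0 ≤ j ≤ N−1) is a polynomial of degree at most 3, with s(x_j) = f_j for 0 ≤ j ≤ N and s(0) = s′(0) = s(1) = s′(1) = 0, then for every u ∈ A with u ≠ s one has ∫_0^1 |s″(x)|² dx < ∫_0^1 |u″(x)|² dx. -/

import Mathlib

open MeasureTheory Set

/-- The bending energy functional `I(u) = ∫₀¹ |u''(x)|² dx`, expressed through a
representative `g` of the (weak) second derivative. -/
noncomputable def energy (g : ℝ → ℝ) : ℝ := ∫ x in (0:ℝ)..1, (g x) ^ 2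

/-- The admissible class `A`: pairs `(u, g)` where `u : [0,1] → ℝ` is continuously
differentiable, its derivative is absolutely continuous with (weak) second derivative
`g ∈ L²(0,1)`, `u` satisfies the clamped boundary conditions, and `u` interpolates the
data `f` at the nodes `x_j = j/N`. -/
def InAdm (N : ℕ) (f : ℕ → ℝ) (u g : ℝ → ℝ) : Prop :=
  ContDiffOn ℝ 1 u (Set.Icc 0 1) ∧
  IntervalIntegrable g MeasureTheory.volume 0 1 ∧
  IntervalIntegrable (fun x => (g x) ^ 2) MeasureTheory.volume 0 1 ∧
  (∀ x ∈ Set.Icc (0:ℝ) 1,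
    derivWithin u (Set.Icc 0 1) x
      = derivWithin u (Set.Icc 0 1) 0 + ∫ t in (0:ℝ)..x, g t) ∧
  u 0 = 0 ∧ u 1 = 0 ∧
  derivWithin u (Set.Icc 0 1) 0 = 0 ∧ derivWithin u (Set.Icc 0 1) 1 = 0 ∧
  ∀ j : ℕ, j ≤ N → u ((j : ℝ) / N) = f j

/-- `IsSpline N f s`: `s` is a type-I cubic spline for the data `f` on the uniform grid
`x_j = j/N`. -/
def IsSpline (N : ℕ) (f : ℕ → ℝ) (s : ℝ → ℝ) : Prop :=
  ContDiff ℝ 2 s ∧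
  (∀ j : ℕ, j < N → ∃ p : Polynomial ℝ, p.degree ≤ 3 ∧
      ∀ x ∈ Set.Icc ((j : ℝ) / N) (((j : ℝ) + 1) / N), s x = p.eval x) ∧
  (∀ j : ℕ, j ≤ N → s ((j : ℝ) / N) = f j) ∧
  s 0 = 0 ∧ deriv s 0 = 0 ∧ s 1 = 0 ∧ deriv s 1 = 0

/-- Integration by parts against the primitive of an integrable function. -/
theorem integral_mul_eq_sub_of_primitive {e φ : ℝ → ℝ} {c d a b : ℝ}
    (he : IntervalIntegrable e volume c d) (hφ : ContDiff ℝ 1 φ)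
    (hab : uIcc a b ⊆ uIcc c d) :
    ∫ x in a..b, φ x * e x =
      φ b * (∫ t in c..b, e t) - φ a * (∫ t in c..a, e t)
        - ∫ x in a..b, deriv φ x * ∫ t in c..x, e t := by
  have hv := (he.absolutelyContinuousOnInterval_intervalIntegral (c := c) (by simp)).mono hab
  have hparts := (hφ.contDiffOn.absolutelyContinuousOnInterval
    (a := a) (b := b)).integral_mul_deriv_eq_deriv_mul hv
  rw [← hparts]
  apply intervalIntegral.integral_congr_ae
  filter_upwards [he.ae_hasDerivAt_integral] with x hx hxab
  rw [(hx (hab (uIoc_subset_uIcc hxab)) c (by simp)).deriv]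

theorem ContDiff.continuous_deriv_deriv {s : ℝ → ℝ} (hs : ContDiff ℝ 2 s) :
    Continuous (deriv (deriv s)) := by
  simpa [iteratedDeriv_succ, iteratedDeriv_zero] using hs.continuous_iteratedDeriv 2 le_rfl

/-- If `s` agrees with a cubic polynomial on `[a, b]`, then its second derivative is given there by
a polynomial with constant derivative. -/
theorem exists_eqOn_deriv_deriv_of_cubic {s : ℝ → ℝ} (hs : ContDiff ℝ 2 s) {p : Polynomial ℝ}
    (hp : p.degree ≤ 3) {a b : ℝ} (hab : a < b) (hsp : EqOn s p.eval (Icc a b)) :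
    ∃ (q : Polynomial ℝ) (c : ℝ), q.derivative = Polynomial.C c ∧
      EqOn (deriv (deriv s)) q.eval (Icc a b) := by
  have hdeg : p.derivative.derivative.derivative.natDegree ≤ 0 := by
    have h0 : p.natDegree ≤ 3 := Polynomial.natDegree_le_of_degree_le hp
    have h1 := p.natDegree_derivative_le
    have h2 := p.derivative.natDegree_derivative_le
    have h3 := p.derivative.derivative.natDegree_derivative_le
    omega
  refine ⟨p.derivative.derivative, _, Polynomial.eq_C_of_natDegree_le_zero hdeg, ?_⟩
  have hderiv : ∀ {F : ℝ → ℝ} {r : Polynomial ℝ}, EqOn F r.eval (Ioo a b) →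
      EqOn (deriv F) r.derivative.eval (Ioo a b) := fun {F r} hF x hx ↦ by
    rw [(hF.eventuallyEq_of_mem (Ioo_mem_nhds hx.1 hx.2)).deriv_eq, r.deriv]
  have hopen := hderiv (hderiv (hsp.mono Ioo_subset_Icc_self))
  exact hopen.of_subset_closure hs.continuous_deriv_deriv.continuousOn
    (Polynomial.continuous _).continuousOn
    Ioo_subset_Icc_self (closure_Ioo hab.ne).ge

/-- If the primitive of `e` is the derivative of a function vanishing at `a` and `b`, and `w` is
affine on `[a, b]`, then the integral of `w * e` over `[a, b]` is a boundary term. -/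
theorem integral_mul_eq_boundary_of_affine {e w D : ℝ → ℝ} {c d a b : ℝ}
    (he : IntervalIntegrable e volume c d) (hab : a ≤ b) (hsub : Icc a b ⊆ uIcc c d)
    {q : Polynomial ℝ} {k : ℝ} (hq : q.derivative = Polynomial.C k)
    (hw : EqOn w q.eval (Icc a b))
    (hD : ∀ x ∈ uIcc c d, HasDerivWithinAt D (∫ t in c..x, e t) (uIcc c d) x)
    (hDa : D a = 0) (hDb : D b = 0) :
    ∫ x in a..b, w x * e x = w b * (∫ t in c..b, e t) - w a * (∫ t in c..a, e t) := by
  have hsub' : uIcc a b ⊆ uIcc c d := by rwa [uIcc_of_le hab]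
  have hprim : ∫ x in a..b, ∫ t in c..x, e t = 0 := by
    have hcont : ContinuousOn (fun x ↦ ∫ t in c..x, e t) (uIcc a b) :=
      ((he.absolutelyContinuousOnInterval_intervalIntegral (c := c) (by simp)).mono
        hsub').continuousOn
    rw [intervalIntegral.integral_eq_sub_of_hasDerivAt_of_le hab (f := D), hDa, hDb, sub_zero]
    · exact fun x hx ↦ ((hD x (hsub hx)).mono hsub).continuousWithinAt
    · exact fun x hx ↦ ((hD x (hsub (Ioo_subset_Icc_self hx))).mono hsub).hasDerivAt
        (Icc_mem_nhds hx.1 hx.2)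
    · exact hcont.intervalIntegrable
  have hcongr : ∫ x in a..b, w x * e x = ∫ x in a..b, q.eval x * e x := by
    refine intervalIntegral.integral_congr fun x hx ↦ ?_
    rw [uIcc_of_le hab] at hx
    simp only [hw hx]
  rw [hcongr,
    integral_mul_eq_sub_of_primitive he (φ := fun x ↦ q.eval x) (q.contDiff_aeval 1) hsub',
    hw (left_mem_Icc.2 hab), hw (right_mem_Icc.2 hab)]
  simp [hq, hprim]

/-- The type-I cubic spline strictly minimizes the bending energy among all admissible
interpolants: for every `u ∈ A` differing from `s` on `[0,1]`,
`∫₀¹ |s''|² < ∫₀¹ |u''|²`. -/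
theorem spline_strict_minimizer
    (N : ℕ) (hN : 2 ≤ N) (f : ℕ → ℝ) (hf0 : f 0 = 0) (hfN : f N = 0)
    (s : ℝ → ℝ) (hs : IsSpline N f s) :
    ∀ u g : ℝ → ℝ, InAdm N f u g → ¬ Set.EqOn u s (Set.Icc 0 1) →
      (∫ x in (0:ℝ)..1, (deriv (deriv s) x) ^ 2) < energy g := by
  rintro u g ⟨hu, hg, hg2, hug, hu0, hu1, hdu0, hdu1, huf⟩ hne
  obtain ⟨hs2, hsp, hsf, hs0, hds0, hs1, hds1⟩ := hs
  set S := deriv (deriv s) with hS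
  have hS_cont : Continuous S := hs2.continuous_deriv_deriv
  have hs_diff : Differentiable ℝ s := hs2.differentiable (by norm_num)
  have hds_diff : Differentiable ℝ (deriv s) :=
    (contDiff_succ_iff_deriv.1 (show ContDiff ℝ (1 + 1) s from hs2)).2.2.differentiable one_ne_zero
  set e : ℝ → ℝ := fun x ↦ g x - S x with he_def
  have he : IntervalIntegrable e volume 0 1 := hg.sub (hS_cont.intervalIntegrable _ _)
  have hsub01 : ∀ x ∈ Icc (0 : ℝ) 1, uIcc 0 x ⊆ uIcc (0 : ℝ) 1 := fun x hx ↦ by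
    rw [uIcc_of_le hx.1, uIcc_of_le zero_le_one]
    exact Icc_subset_Icc_right hx.2
  have hprim : ∀ x ∈ Icc (0 : ℝ) 1,
      derivWithin u (Icc 0 1) x - deriv s x = ∫ t in (0 : ℝ)..x, e t := fun x hx ↦ by
    rw [intervalIntegral.integral_sub (hg.mono_set (hsub01 x hx))
      (hS_cont.intervalIntegrable _ _), hug x hx, hdu0, hS,
      intervalIntegral.integral_deriv_eq_sub (fun y _ ↦ hds_diff y)
        (hS_cont.intervalIntegrable _ _), hds0]
    ring
  have hD : ∀ x ∈ uIcc (0 : ℝ) 1,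
      HasDerivWithinAt (fun y ↦ u y - s y) (∫ t in (0 : ℝ)..x, e t) (uIcc 0 1) x := by
    rw [uIcc_of_le zero_le_one]
    intro x hx
    rw [← hprim x hx]
    exact (hu.differentiableOn one_ne_zero x hx).hasDerivWithinAt.sub
      (hs_diff x).hasDerivAt.hasDerivWithinAt
  have hv1 : ∫ t in (0 : ℝ)..1, e t = 0 := by
    rw [← hprim 1 (right_mem_Icc.2 zero_le_one), hdu1, hds1, sub_zero]
  have hSe : IntervalIntegrable (fun x ↦ S x * e x) volume 0 1 :=
    he.continuousOn_mul hS_cont.continuousOn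
  have hN0 : (0 : ℝ) < N := by exact_mod_cast (by omega : 0 < N)
  have hnode : ∀ j < N, (j : ℝ) / N < ((j + 1 : ℕ) : ℝ) / N ∧
      Icc ((j : ℝ) / N) (((j + 1 : ℕ) : ℝ) / N) ⊆ uIcc 0 1 := fun j hj ↦ by
    refine ⟨by gcongr; simp, ?_⟩
    rw [uIcc_of_le zero_le_one]
    refine Icc_subset_Icc (by positivity) ((div_le_one hN0).2 ?_)
    exact_mod_cast hj
  have horth : ∫ x in (0 : ℝ)..1, S x * e x = 0 := by
    have hsum := intervalIntegral.sum_integral_adjacent_intervals (μ := volume)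
      (f := fun x ↦ S x * e x) (a := fun j : ℕ ↦ (j : ℝ) / N) (n := N) fun j hj ↦
        hSe.mono_set (by rw [uIcc_of_le (hnode j hj).1.le]; exact (hnode j hj).2)
    have hpiece : ∀ j ∈ Finset.range N,
        ∫ x in ((j : ℝ) / N)..(((j + 1 : ℕ) : ℝ) / N), S x * e x =
          S (((j + 1 : ℕ) : ℝ) / N) * (∫ t in (0 : ℝ)..(((j + 1 : ℕ) : ℝ) / N), e t) -
          S ((j : ℝ) / N) * ∫ t in (0 : ℝ)..((j : ℝ) / N), e t := by
      intro j hj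
      rw [Finset.mem_range] at hj
      obtain ⟨p, hp, hps⟩ := hsp j hj
      obtain ⟨q, k, hq, hSq⟩ := exists_eqOn_deriv_deriv_of_cubic hs2 hp (hnode j hj).1
        (fun x hx ↦ hps x (by simpa using hx))
      exact integral_mul_eq_boundary_of_affine he (hnode j hj).1.le (hnode j hj).2 hq hSq hD
        (by rw [huf j hj.le, hsf j hj.le, sub_self])
        (by rw [huf (j + 1) hj, hsf (j + 1) hj, sub_self])
    rw [Finset.sum_congr rfl hpiece, Finset.sum_range_sub fun i : ℕ ↦
      S ((i : ℝ) / N) * ∫ t in (0 : ℝ)..((i : ℝ) / N), e t] at hsum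
    simpa [div_self hN0.ne', hv1] using hsum.symm
  have hS2 : IntervalIntegrable (fun x ↦ S x ^ 2) volume 0 1 :=
    (hS_cont.pow 2).intervalIntegrable _ _
  have he2 : IntervalIntegrable (fun x ↦ e x ^ 2) volume 0 1 := by
    refine ((hg2.sub hS2).sub (hSe.const_mul 2)).congr fun x _ ↦ ?_
    simp only [he_def]
    ring
  have hpyth : energy g = (∫ x in (0 : ℝ)..1, S x ^ 2) + ∫ x in (0 : ℝ)..1, e x ^ 2 := by
    have hexpand : ∀ x, g x ^ 2 = S x ^ 2 + 2 * (S x * e x) + e x ^ 2 := fun x ↦ by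
      simp only [he_def]
      ring
    simp only [energy, hexpand]
    rw [intervalIntegral.integral_add (hS2.add (hSe.const_mul 2)) he2,
      intervalIntegral.integral_add hS2 (hSe.const_mul 2),
      intervalIntegral.integral_const_mul, horth, mul_zero, add_zero]
  rw [hpyth]
  have he2_nonneg : 0 ≤ ∫ x in (0 : ℝ)..1, e x ^ 2 :=
    intervalIntegral.integral_nonneg zero_le_one fun x _ ↦ sq_nonneg _
  refine lt_add_of_pos_right _ (he2_nonneg.lt_of_ne fun hzero ↦ hne ?_)
  have he_ae : e =ᵐ[volume.restrict (Ioc 0 1)] 0 := by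
    have := (intervalIntegral.integral_eq_zero_iff_of_le_of_nonneg_ae zero_le_one
      (Filter.Eventually.of_forall fun x ↦ sq_nonneg (e x)) he2).1 hzero.symm
    filter_upwards [this] with x hx
    exact pow_eq_zero_iff two_ne_zero |>.1 hx
  have hv0 : ∀ x ∈ Icc (0 : ℝ) 1, ∫ t in (0 : ℝ)..x, e t = 0 := fun x hx ↦ by
    rw [intervalIntegral.integral_of_le hx.1]
    exact integral_eq_zero_of_ae
      (ae_restrict_of_ae_restrict_of_subset (Ioc_subset_Ioc_right hx.2) he_ae)
  rw [uIcc_of_le zero_le_one] at hD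
  intro x hx
  have hconst := (convex_Icc (0 : ℝ) 1).norm_image_sub_le_of_norm_hasDerivWithin_le (C := 0) hD
    (fun y hy ↦ by rw [hv0 y hy, norm_zero]) (left_mem_Icc.2 zero_le_one) hx
  rw [zero_mul, norm_le_zero_iff, hu0, hs0] at hconst
  linarith
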